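/- arXiv:2312.04464 — 4 statements merged into one kernel-verified Lean document; each statement's English description precedes it below -/
import Mathlib

section
/- Let 𝒳 be a set, F a class of real-valued functions on 𝒳, λ > 0, points X_1, …, X_t ∈ 𝒳 and positive weights σ_1, …, σ_{t−1} > 0. Then for any 1 ≤ t₀ < t, D²_F(X_t; X_{[t₀]}, σ_{[t₀]}) ≤ exp( Σ_{s=t₀+1}^{t−1} σ_s^{−2} D²_F(X_s; X_{[s−1]}, σ_{[s−1]}) ) · D²_F(X_t; X_{[t−1]}, σ_{[t−1]}). -/
/-- The set of ratios whose supremum defines the squared uncertainty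
`D²_F(x; X_[n], σ_[n])` of a query point `x` against a history `X_1, …, X_n`
(indexed `1, …, n`) with weights `σ_1, …, σ_n`. -/
def uncSet {𝒳 : Type*} (F : Set (𝒳 → ℝ)) (lam : ℝ) (xs : ℕ → 𝒳) (sig : ℕ → ℝ)
    (n : ℕ) (x : 𝒳) : Set ℝ :=
  { r | ∃ f₁ ∈ F, ∃ f₂ ∈ F,
      r = (f₁ x - f₂ x) ^ 2 /
        ((∑ s ∈ Finset.Icc 1 n, (sig s ^ 2)⁻¹ * (f₁ (xs s) - f₂ (xs s)) ^ 2) + lam) }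

/-- Squared uncertainty `D²_F(x; X_[n], σ_[n])`. -/
noncomputable def uncertaintySq {𝒳 : Type*} (F : Set (𝒳 → ℝ)) (lam : ℝ)
    (xs : ℕ → 𝒳) (sig : ℕ → ℝ) (n : ℕ) (x : 𝒳) : ℝ :=
  sSup (uncSet F lam xs sig n x)

theorem uncertaintySq_nonneg {𝒳 : Type*} (F : Set (𝒳 → ℝ)) {lam : ℝ} (hlam : 0 < lam)
    (xs : ℕ → 𝒳) (sig : ℕ → ℝ) (n : ℕ) (x : 𝒳) :
    0 ≤ uncertaintySq F lam xs sig n x := by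
  refine Real.sSup_nonneg ?_
  rintro _ ⟨f₁, -, f₂, -, rfl⟩
  positivity

theorem div_le_uncertaintySq {𝒳 : Type*} {F : Set (𝒳 → ℝ)} {lam : ℝ} {xs : ℕ → 𝒳}
    {sig : ℕ → ℝ} {n : ℕ} {x : 𝒳} (hbdd : BddAbove (uncSet F lam xs sig n x))
    {f₁ f₂ : 𝒳 → ℝ} (h₁ : f₁ ∈ F) (h₂ : f₂ ∈ F) :
    (f₁ x - f₂ x) ^ 2 /
        ((∑ s ∈ Finset.Icc 1 n, (sig s ^ 2)⁻¹ * (f₁ (xs s) - f₂ (xs s)) ^ 2) + lam) ≤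
      uncertaintySq F lam xs sig n x :=
  le_csSup hbdd ⟨f₁, h₁, f₂, h₂, rfl⟩

/-- Adding one point to the history decreases the squared uncertainty at most by the factor
`exp(σ_{n+1}⁻² D²_F(X_{n+1}; X_[n], σ_[n]))`. -/
theorem uncertaintySq_le_exp_mul_uncertaintySq_succ {𝒳 : Type*} (F : Set (𝒳 → ℝ)) {lam : ℝ}
    (hlam : 0 < lam) (xs : ℕ → 𝒳) (sig : ℕ → ℝ)
    (hbdd : ∀ n x, BddAbove (uncSet F lam xs sig n x)) (n : ℕ) (x : 𝒳) :
    uncertaintySq F lam xs sig n x ≤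
      Real.exp ((sig (n + 1) ^ 2)⁻¹ * uncertaintySq F lam xs sig n (xs (n + 1))) *
        uncertaintySq F lam xs sig (n + 1) x := by
  refine Real.sSup_le ?_
    (mul_nonneg (Real.exp_nonneg _) (uncertaintySq_nonneg F hlam xs sig _ _))
  rintro _ ⟨f₁, h₁, f₂, h₂, rfl⟩
  have hx := div_le_uncertaintySq (hbdd (n + 1) x) h₁ h₂
  have hnew := div_le_uncertaintySq (hbdd n (xs (n + 1))) h₁ h₂
  rw [Finset.sum_Icc_succ_top (by lia)] at hx
  set S := ∑ s ∈ Finset.Icc 1 n, (sig s ^ 2)⁻¹ * (f₁ (xs s) - f₂ (xs s)) ^ 2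
  set c := (sig (n + 1) ^ 2)⁻¹
  set d := (f₁ (xs (n + 1)) - f₂ (xs (n + 1))) ^ 2
  have hS : 0 ≤ S := Finset.sum_nonneg fun s _ => by positivity
  have hc : 0 ≤ c := by positivity
  have hd : 0 ≤ d := by positivity
  have hratio : 1 + c * (d / (S + lam)) ≤
      Real.exp (c * uncertaintySq F lam xs sig n (xs (n + 1))) := by
    have := mul_le_mul_of_nonneg_left hnew hc
    linarith [Real.add_one_le_exp (c * uncertaintySq F lam xs sig n (xs (n + 1)))]
  calc (f₁ x - f₂ x) ^ 2 / (S + lam)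
      = (1 + c * (d / (S + lam))) * ((f₁ x - f₂ x) ^ 2 / (S + c * d + lam)) := by
        have : S + lam ≠ 0 := by positivity
        have : S + c * d + lam ≠ 0 := by positivity
        field_simp
        ring
    _ ≤ _ := mul_le_mul hratio hx (by positivity) (Real.exp_nonneg _)

/-- For `1 ≤ t₀ < t`,
`D²_F(X_t; X_[t₀], σ_[t₀]) ≤ exp(Σ_{s=t₀+1}^{t-1} σ_s⁻² D²_F(X_s; X_[s-1], σ_[s-1])) ·
D²_F(X_t; X_[t-1], σ_[t-1])`. -/
theorem uncertaintySq_le_exp_mul_uncertaintySq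
    {𝒳 : Type*} (F : Set (𝒳 → ℝ)) (lam : ℝ) (hlam : 0 < lam)
    (xs : ℕ → 𝒳) (sig : ℕ → ℝ) (hsig : ∀ s, 0 < sig s)
    (hbdd : ∀ n x, BddAbove (uncSet F lam xs sig n x))
    (t₀ t : ℕ) (ht₀ : 1 ≤ t₀) (ht : t₀ < t) :
    uncertaintySq F lam xs sig t₀ (xs t) ≤
      Real.exp (∑ s ∈ Finset.Icc (t₀ + 1) (t - 1),
          (sig s ^ 2)⁻¹ * uncertaintySq F lam xs sig (s - 1) (xs s)) *
        uncertaintySq F lam xs sig (t - 1) (xs t) := by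
  obtain ⟨n, rfl⟩ : ∃ n, t = n + 1 := ⟨t - 1, by lia⟩
  rw [Nat.add_sub_cancel]
  generalize xs (n + 1) = x
  have hn : t₀ ≤ n := by lia
  clear ht
  induction n, hn using Nat.le_induction with
  | base => simp
  | succ n hn ih =>
    rw [Finset.sum_Icc_succ_top (by lia), Real.exp_add, mul_assoc, Nat.add_sub_cancel]
    exact ih.trans (mul_le_mul_of_nonneg_left
      (uncertaintySq_le_exp_mul_uncertaintySq_succ F hlam xs sig hbdd n x) (Real.exp_nonneg _))
end

section
/- Let d ≥ 1, B > 0, λ > 0, and let φ : 𝒳 → ℝ^d satisfy ‖φ(x)‖₂ ≤ 1 for all x ∈ 𝒳. Let F = { x ↦ ⟨θ, φ(x)⟩ : θ ∈ ℝ^d, ‖θ‖₂ ≤ B } be the corresponding class of linear functions. Then for any 0 < σ_min and any T ≥ 1, the generalized Eluder dimension satisfies dim_F(σ_min, T) ≤ 2 d · log( 1 + 4 T B² / (d λ σ_min²) ). -/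
/-- Generalized Eluder dimension `dim_F(σ_min, T)`. -/
noncomputable def eluderDim {𝒳 : Type*} (F : Set (𝒳 → ℝ)) (lam smin : ℝ) (T : ℕ) : ℝ :=
  ⨆ p : (ℕ → 𝒳) × {s : ℕ → ℝ // ∀ t, smin ≤ s t},
    ∑ t ∈ Finset.Icc 1 T,
      min 1 ((p.2.1 t ^ 2)⁻¹ * uncertaintySq F lam p.1 p.2.1 (t - 1) (p.1 t))

open Matrix in
/-- The regularized weighted Gram matrix `μ I + ∑ s ∈ [1, n], w s • z s (z s)ᵀ`. -/
noncomputable def regGram {ι : Type*} [DecidableEq ι] (μ : ℝ) (w : ℕ → ℝ) (z : ℕ → ι → ℝ)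
    (n : ℕ) : Matrix ι ι ℝ :=
  μ • (1 : Matrix ι ι ℝ) + ∑ s ∈ Finset.Icc 1 n, w s • vecMulVec (z s) (z s)

section RegGram

open Matrix

variable {ι : Type*} [DecidableEq ι]

lemma regGram_zero (μ : ℝ) (w : ℕ → ℝ) (z : ℕ → ι → ℝ) :
    regGram μ w z 0 = μ • (1 : Matrix ι ι ℝ) := by
  simp [regGram]

lemma regGram_succ (μ : ℝ) (w : ℕ → ℝ) (z : ℕ → ι → ℝ) (n : ℕ) :
    regGram μ w z (n + 1) =
      regGram μ w z n + w (n + 1) • vecMulVec (z (n + 1)) (z (n + 1)) := by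
  simp [regGram, Finset.sum_Icc_succ_top, add_assoc]

variable [Fintype ι]

lemma regGram_posDef {μ : ℝ} (hμ : 0 < μ) {w : ℕ → ℝ} (hw : ∀ s, 0 ≤ w s) (z : ℕ → ι → ℝ)
    (n : ℕ) : (regGram μ w z n).PosDef := by
  refine (PosDef.one.smul hμ).add_posSemidef (posSemidef_sum _ fun s _ => ?_)
  simpa using (posSemidef_vecMulVec_self_star (z s)).smul (hw s)

lemma dotProduct_regGram_mulVec (μ : ℝ) (w : ℕ → ℝ) (z : ℕ → ι → ℝ) (n : ℕ) (v : ι → ℝ) :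
    v ⬝ᵥ regGram μ w z n *ᵥ v =
      μ * (v ⬝ᵥ v) + ∑ s ∈ Finset.Icc 1 n, w s * (v ⬝ᵥ z s) ^ 2 := by
  simp only [regGram, add_mulVec, sum_mulVec, smul_mulVec, one_mulVec, vecMulVec_mulVec,
    dotProduct_add, dotProduct_sum, dotProduct_smul, smul_eq_mul, op_smul_eq_smul]
  congr 1
  refine Finset.sum_congr rfl fun s _ => ?_
  rw [dotProduct_comm (z s) v]
  ring

lemma trace_regGram (μ : ℝ) (w : ℕ → ℝ) (z : ℕ → ι → ℝ) (n : ℕ) :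
    (regGram μ w z n).trace =
      μ * Fintype.card ι + ∑ s ∈ Finset.Icc 1 n, w s * (z s ⬝ᵥ z s) := by
  simp [regGram, trace_add, trace_sum, trace_smul, trace_vecMulVec]

/-- Cauchy–Schwarz inequality for the dual pair of norms given by `M` and `M⁻¹`. -/
lemma Matrix.PosDef.sq_dotProduct_le {M : Matrix ι ι ℝ} (hM : M.PosDef) (v x : ι → ℝ) :
    (v ⬝ᵥ x) ^ 2 ≤ (x ⬝ᵥ M⁻¹ *ᵥ x) * (v ⬝ᵥ M *ᵥ v) := by
  have hdet : IsUnit M.det := (isUnit_iff_isUnit_det M).1 hM.isUnit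
  have hx : M *ᵥ (M⁻¹ *ᵥ x) = x := by
    rw [mulVec_mulVec, mul_nonsing_inv _ hdet, one_mulVec]
  have hsymm : ∀ u : ι → ℝ, (M⁻¹ *ᵥ x) ⬝ᵥ M *ᵥ u = x ⬝ᵥ u := fun u => by
    have hMt : Mᵀ = M := by simpa using hM.isHermitian.eq
    rw [dotProduct_mulVec, ← mulVec_transpose, hMt, hx]
  have hquad : ∀ r : ℝ, 0 ≤ (x ⬝ᵥ M⁻¹ *ᵥ x) * (r * r) + (2 * (v ⬝ᵥ x)) * r
      + v ⬝ᵥ M *ᵥ v := fun r => by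
    have h := hM.posSemidef.dotProduct_mulVec_nonneg (r • (M⁻¹ *ᵥ x) + v)
    simp only [star_trivial, mulVec_add, mulVec_smul, hx, add_dotProduct, dotProduct_add,
      smul_dotProduct, dotProduct_smul, smul_eq_mul, hsymm, dotProduct_comm (M⁻¹ *ᵥ x) x,
      dotProduct_comm x v] at h
    linarith
  have h := discrim_le_zero hquad
  rw [discrim] at h
  linarith

/-- Matrix determinant lemma for a symmetric weighted rank-one update. -/
lemma Matrix.det_add_smul_vecMulVec {M : Matrix ι ι ℝ} (hM : IsUnit M.det) (c : ℝ)
    (x : ι → ℝ) :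
    (M + c • vecMulVec x x).det = M.det * (1 + c * (x ⬝ᵥ M⁻¹ *ᵥ x)) := by
  rw [← smul_vecMulVec, vecMulVec_eq Unit, det_add_mul _ _ hM, det_unique (n := Unit)]
  congr 1
  rw [Matrix.add_apply, one_apply_eq, Matrix.mul_assoc, ← replicateCol_mulVec,
    replicateRow_mul_replicateCol_apply, mulVec_smul, dotProduct_smul, smul_eq_mul]

/-- Arithmetic–geometric mean inequality for the eigenvalues of a positive definite matrix. -/
lemma Matrix.PosDef.log_det_le [Nonempty ι] {M : Matrix ι ι ℝ} (hM : M.PosDef) :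
    Real.log M.det ≤ Fintype.card ι * Real.log (M.trace / Fintype.card ι) := by
  have hcard : (0 : ℝ) < Fintype.card ι := by exact_mod_cast Fintype.card_pos
  have hm : 0 < M.trace / Fintype.card ι := div_pos hM.trace_pos hcard
  have htr : M.trace = ∑ i, hM.isHermitian.eigenvalues i := by
    simpa using hM.isHermitian.trace_eq_sum_eigenvalues
  have hdet : M.det = ∏ i, hM.isHermitian.eigenvalues i := by
    simpa using hM.isHermitian.det_eq_prod_eigenvalues
  have hlog : ∀ i, Real.log (hM.isHermitian.eigenvalues i) ≤
      Real.log (M.trace / Fintype.card ι) +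
        (hM.isHermitian.eigenvalues i / (M.trace / Fintype.card ι) - 1) := fun i => by
    have h := Real.log_le_sub_one_of_pos (div_pos (hM.eigenvalues_pos i) hm)
    rw [Real.log_div (hM.eigenvalues_pos i).ne' hm.ne'] at h
    linarith
  calc Real.log M.det = ∑ i, Real.log (hM.isHermitian.eigenvalues i) := by
        rw [hdet, Real.log_prod fun i _ => (hM.eigenvalues_pos i).ne']
    _ ≤ _ := Finset.sum_le_sum fun i _ => hlog i
    _ = _ := by
        rw [Finset.sum_add_distrib, Finset.sum_sub_distrib, ← Finset.sum_div, ← htr,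
          div_div_cancel₀ hM.trace_pos.ne']
        simp

lemma min_one_le_two_mul_log {x : ℝ} (hx : 0 ≤ x) : min 1 x ≤ 2 * Real.log (1 + x) := by
  have hy : 0 ≤ min 1 x := le_min zero_le_one hx
  have hy1 : min 1 x ≤ 1 := min_le_left _ _
  have hmono : Real.log (1 + min 1 x) ≤ Real.log (1 + x) :=
    Real.log_le_log (by linarith) (by linarith [min_le_right 1 x])
  have hlog := Real.one_sub_inv_le_log_of_pos (show 0 < 1 + min 1 x by linarith)
  have hhalf : min 1 x / 2 ≤ 1 - (1 + min 1 x)⁻¹ := by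
    have : 1 - (1 + min 1 x)⁻¹ = min 1 x / (1 + min 1 x) := by
      field_simp
      ring
    rw [this]
    gcongr
    linarith
  linarith

/-- The elliptical potential lemma. -/
lemma sum_min_one_le_log_det_regGram {μ : ℝ} (hμ : 0 < μ) {w : ℕ → ℝ} (hw : ∀ s, 0 ≤ w s)
    (z : ℕ → ι → ℝ) (n : ℕ) :
    ∑ t ∈ Finset.Icc 1 n, min 1 (w t * (z t ⬝ᵥ (regGram μ w z (t - 1))⁻¹ *ᵥ z t)) ≤
      2 * (Real.log (regGram μ w z n).det - Fintype.card ι * Real.log μ) := by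
  induction n with
  | zero => simp [regGram_zero, Real.log_pow]
  | succ n ih =>
    have hpd := regGram_posDef hμ hw z n
    have hq : 0 ≤ w (n + 1) * (z (n + 1) ⬝ᵥ (regGram μ w z n)⁻¹ *ᵥ z (n + 1)) :=
      mul_nonneg (hw _)
        (by simpa using hpd.inv.posSemidef.dotProduct_mulVec_nonneg (z (n + 1)))
    rw [Finset.sum_Icc_succ_top (by omega), Nat.add_sub_cancel, regGram_succ,
      det_add_smul_vecMulVec hpd.det_pos.ne'.isUnit,
      Real.log_mul hpd.det_pos.ne' (by positivity)]
    linarith [min_one_le_two_mul_log hq]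

lemma log_det_regGram_sub_le [Nonempty ι] {μ c : ℝ} (hμ : 0 < μ) {w : ℕ → ℝ}
    (hw : ∀ s, 0 ≤ w s) (hwc : ∀ s, w s ≤ c) {z : ℕ → ι → ℝ} (hz : ∀ s, z s ⬝ᵥ z s ≤ 1)
    (n : ℕ) :
    Real.log (regGram μ w z n).det - Fintype.card ι * Real.log μ ≤
      Fintype.card ι * Real.log (1 + n * c / (Fintype.card ι * μ)) := by
  have hpd := regGram_posDef hμ hw z n
  have hcard : (0 : ℝ) < Fintype.card ι := by exact_mod_cast Fintype.card_pos
  have htr : (regGram μ w z n).trace ≤ μ * Fintype.card ι + n * c := by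
    rw [trace_regGram]
    gcongr
    calc ∑ s ∈ Finset.Icc 1 n, w s * (z s ⬝ᵥ z s) ≤ ∑ s ∈ Finset.Icc 1 n, c :=
          Finset.sum_le_sum fun s _ =>
            (mul_le_of_le_one_right (hw s) (hz s)).trans (hwc s)
      _ = n * c := by simp
  have hpos := div_pos (div_pos hpd.trace_pos hcard) hμ
  have hle : (regGram μ w z n).trace / Fintype.card ι / μ ≤
      1 + n * c / (Fintype.card ι * μ) := by
    rw [div_div, div_le_iff₀ (by positivity)]
    refine htr.trans_eq ?_
    field_simp
  have hlog := Real.log_le_log hpos hle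
  rw [Real.log_div (div_pos hpd.trace_pos hcard).ne' hμ.ne'] at hlog
  nlinarith [hpd.log_det_le]

end RegGram

section LinearClass

open Matrix

variable {𝒳 ι : Type*} [Fintype ι]

lemma dotProduct_sub_self_le {B : ℝ} {θ₁ θ₂ : ι → ℝ} (h₁ : θ₁ ⬝ᵥ θ₁ ≤ B ^ 2)
    (h₂ : θ₂ ⬝ᵥ θ₂ ≤ B ^ 2) : (θ₁ - θ₂) ⬝ᵥ (θ₁ - θ₂) ≤ 4 * B ^ 2 := by
  have h : 0 ≤ (θ₁ + θ₂) ⬝ᵥ (θ₁ + θ₂) := by simpa using dotProduct_star_self_nonneg (θ₁ + θ₂)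
  simp only [add_dotProduct, dotProduct_add, sub_dotProduct, dotProduct_sub] at h ⊢
  linarith

lemma uncertaintySq_linear_le [DecidableEq ι] {F : Set (𝒳 → ℝ)} {φ : 𝒳 → ι → ℝ} {B lam : ℝ} (hB : 0 < B)
    (hlam : 0 < lam) (hF : ∀ f ∈ F, ∃ θ : ι → ℝ, θ ⬝ᵥ θ ≤ B ^ 2 ∧ f = fun x => θ ⬝ᵥ φ x)
    (xs : ℕ → 𝒳) (sig : ℕ → ℝ) (n : ℕ) (x : 𝒳) :
    uncertaintySq F lam xs sig n x ≤
      φ x ⬝ᵥ (regGram (lam / (4 * B ^ 2)) (fun s => (sig s ^ 2)⁻¹) (fun s => φ (xs s)) n)⁻¹ *ᵥ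
        φ x := by
  have hpd := regGram_posDef (μ := lam / (4 * B ^ 2)) (by positivity)
    (w := fun s => (sig s ^ 2)⁻¹) (fun s => by positivity) (fun s => φ (xs s)) n
  have hq : 0 ≤ φ x ⬝ᵥ (regGram (lam / (4 * B ^ 2)) (fun s => (sig s ^ 2)⁻¹)
      (fun s => φ (xs s)) n)⁻¹ *ᵥ φ x := by
    simpa using hpd.inv.posSemidef.dotProduct_mulVec_nonneg (φ x)
  refine Real.sSup_le ?_ hq
  rintro r ⟨f₁, hf₁, f₂, hf₂, rfl⟩
  obtain ⟨θ₁, h₁, rfl⟩ := hF f₁ hf₁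
  obtain ⟨θ₂, h₂, rfl⟩ := hF f₂ hf₂
  simp only [← sub_dotProduct]
  have hsum : 0 ≤ ∑ s ∈ Finset.Icc 1 n, (sig s ^ 2)⁻¹ * ((θ₁ - θ₂) ⬝ᵥ φ (xs s)) ^ 2 :=
    Finset.sum_nonneg fun s _ => by positivity
  rw [div_le_iff₀ (by linarith)]
  refine (hpd.sq_dotProduct_le (θ₁ - θ₂) (φ x)).trans (mul_le_mul_of_nonneg_left ?_ hq)
  rw [dotProduct_regGram_mulVec, add_comm]
  gcongr
  calc lam / (4 * B ^ 2) * ((θ₁ - θ₂) ⬝ᵥ (θ₁ - θ₂)) ≤ lam / (4 * B ^ 2) * (4 * B ^ 2) := by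
        gcongr
        exact dotProduct_sub_self_le h₁ h₂
    _ = lam := by field_simp

end LinearClass

/-- Proposition 1, Eluder-dimension half: for the class of
`B`-bounded `d`-dimensional linear functions over features `φ` with `‖φ(x)‖₂ ≤ 1`,
`dim_F(σ_min, T) ≤ 2d log(1 + 4TB²/(dλσ_min²))`. -/
theorem eluderDim_linear_le
    {𝒳 : Type*} [Nonempty 𝒳] (d : ℕ) (hd : 1 ≤ d) (B lam : ℝ)
    (hB : 0 < B) (hlam : 0 < lam)
    (φ : 𝒳 → Fin d → ℝ) (hφ : ∀ x, Real.sqrt (∑ i, φ x i ^ 2) ≤ 1)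
    (F : Set (𝒳 → ℝ))
    (hF : F = { f | ∃ θ : Fin d → ℝ, Real.sqrt (∑ i, θ i ^ 2) ≤ B ∧
      f = fun x => ∑ i, θ i * φ x i })
    (smin : ℝ) (hsmin : 0 < smin) (T : ℕ) (hT : 1 ≤ T) :
    eluderDim F lam smin T ≤
      2 * d * Real.log (1 + 4 * T * B ^ 2 / (d * lam * smin ^ 2)) := by
  have hsq : ∀ v : Fin d → ℝ, ∑ i, v i ^ 2 = v ⬝ᵥ v := fun v => by
    simp [dotProduct, sq]
  have hz : ∀ x, φ x ⬝ᵥ φ x ≤ 1 := fun x => by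
    simpa [hsq] using (Real.sqrt_le_left zero_le_one).1 (hφ x)
  have hF' : ∀ f ∈ F, ∃ θ : Fin d → ℝ, θ ⬝ᵥ θ ≤ B ^ 2 ∧ f = fun x => θ ⬝ᵥ φ x := by
    rw [hF]
    rintro f ⟨θ, hθ, rfl⟩
    exact ⟨θ, by rw [← hsq]; exact (Real.sqrt_le_left hB.le).1 hθ, rfl⟩
  have : Nonempty (Fin d) := ⟨⟨0, hd⟩⟩
  have hμ : 0 < lam / (4 * B ^ 2) := by positivity
  obtain ⟨x₀⟩ := ‹Nonempty 𝒳›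
  have : Nonempty ((ℕ → 𝒳) × {s : ℕ → ℝ // ∀ t, smin ≤ s t}) :=
    ⟨fun _ => x₀, fun _ => smin, fun _ => le_rfl⟩
  refine ciSup_le ?_
  rintro ⟨xs, sig, hsig⟩
  have hw : ∀ s, 0 ≤ (sig s ^ 2)⁻¹ := fun s => by positivity
  have hwc : ∀ s, (sig s ^ 2)⁻¹ ≤ (smin ^ 2)⁻¹ := fun s => by
    gcongr
    exact hsig s
  have hpot := sum_min_one_le_log_det_regGram hμ hw (fun s => φ (xs s)) T
  have hdet := log_det_regGram_sub_le hμ hw hwc (fun s => hz (xs s)) T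
  rw [Fintype.card_fin] at hpot hdet
  have harg : T * (smin ^ 2)⁻¹ / (d * (lam / (4 * B ^ 2))) =
      4 * T * B ^ 2 / (d * lam * smin ^ 2) := by
    field_simp
  rw [harg] at hdet
  refine le_trans (Finset.sum_le_sum fun t _ => min_le_min_left 1 ?_)
    (hpot.trans (by linarith))
  exact mul_le_mul_of_nonneg_left (uncertaintySq_linear_le hB hlam hF' xs sig (t - 1) (xs t))
    (hw t)
end

section
/- Let d ≥ 1, B > 0, λ > 0, and let φ : 𝒳 → ℝ^d satisfy ‖φ(x)‖₂ ≤ 1 for all x ∈ 𝒳. Let F = { x ↦ ⟨θ, φ(x)⟩ : θ ∈ ℝ^d, ‖θ‖₂ ≤ B }. Fix points X_1, …, X_t ∈ 𝒳 and positive weights σ_1, …, σ_{t−1}, write φ_s = φ(X_s), and define the positive-definite matrix Σ_{t−1} = Σ_{s=1}^{t−1} σ_s^{−2} φ_s φ_sᵀ + (λ / (4B²)) · I_d. Then the uncertainty satisfies D_F(X_t; X_{[t−1]}, σ_{[t−1]}) ≤ ‖φ_t‖_{Σ_{t−1}^{−1}}, where ‖v‖_A := √(vᵀ A v). -/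
open Matrix

/-- Cauchy–Schwarz for the bilinear form of a positive semidefinite real matrix. -/
lemma Matrix.PosSemidef.sq_dotProduct_mulVec_le {n : Type*} [Fintype n]
    {A : Matrix n n ℝ} (hA : A.PosSemidef) (u v : n → ℝ) :
    (v ⬝ᵥ A *ᵥ u) ^ 2 ≤ (v ⬝ᵥ A *ᵥ v) * (u ⬝ᵥ A *ᵥ u) := by
  have hsymm : u ⬝ᵥ A *ᵥ v = v ⬝ᵥ A *ᵥ u := by
    have hT : Aᵀ = A := by simpa using hA.isHermitian.eq
    rw [dotProduct_mulVec, ← mulVec_transpose, hT, dotProduct_comm]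
  have h := discrim_le_zero (a := u ⬝ᵥ A *ᵥ u) (b := 2 * (v ⬝ᵥ A *ᵥ u))
    (c := v ⬝ᵥ A *ᵥ v) fun x => by
      have hx := hA.dotProduct_mulVec_nonneg (x • u + v)
      simp only [star_trivial, mulVec_add, mulVec_smul, dotProduct_add, add_dotProduct,
        smul_dotProduct, dotProduct_smul, smul_eq_mul, hsymm] at hx
      linarith
  rw [discrim] at h
  linarith

/-- Cauchy–Schwarz for the dual pair of norms given by a positive definite real matrix and its
inverse. -/
lemma Matrix.PosDef.sq_dotProduct_le_s5 {n : Type*} [Fintype n] [DecidableEq n]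
    {A : Matrix n n ℝ} (hA : A.PosDef) (v w : n → ℝ) :
    (v ⬝ᵥ w) ^ 2 ≤ (v ⬝ᵥ A *ᵥ v) * (w ⬝ᵥ A⁻¹ *ᵥ w) := by
  have hw : A *ᵥ (A⁻¹ *ᵥ w) = w := by
    rw [mulVec_mulVec, mul_nonsing_inv _ ((isUnit_iff_isUnit_det A).mp hA.isUnit), one_mulVec]
  have h := hA.posSemidef.sq_dotProduct_mulVec_le (A⁻¹ *ᵥ w) v
  rwa [hw, dotProduct_comm (A⁻¹ *ᵥ w) w] at h

/-- A weighted Gram matrix with a positive multiple of the identity added is positive definite. -/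
lemma Matrix.posDef_sum_smul_vecMulVec_add_smul_one {ι n : Type*} [Fintype n] [DecidableEq n]
    (S : Finset ι) (w : ι → ℝ) (hw : ∀ s ∈ S, 0 ≤ w s) (u : ι → n → ℝ) {c : ℝ} (hc : 0 < c) :
    (∑ s ∈ S, w s • vecMulVec (u s) (u s) + c • (1 : Matrix n n ℝ)).PosDef := by
  refine PosDef.posSemidef_add (posSemidef_sum S fun s hs => ?_) (PosDef.one.smul hc)
  simpa using (posSemidef_vecMulVec_self_star (u s)).smul (hw s hs)

/-- The quadratic form of a regularized weighted Gram matrix. -/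
lemma Matrix.dotProduct_sum_smul_vecMulVec_add_smul_one_mulVec {ι n : Type*} [Fintype n]
    [DecidableEq n] (S : Finset ι) (w : ι → ℝ) (u : ι → n → ℝ) (c : ℝ) (v : n → ℝ) :
    v ⬝ᵥ (∑ s ∈ S, w s • vecMulVec (u s) (u s) + c • (1 : Matrix n n ℝ)) *ᵥ v =
      ∑ s ∈ S, w s * (v ⬝ᵥ u s) ^ 2 + c * (v ⬝ᵥ v) := by
  rw [add_mulVec, dotProduct_add, sum_mulVec, dotProduct_sum, smul_mulVec, one_mulVec,
    dotProduct_smul, smul_eq_mul]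
  congr 1
  refine Finset.sum_congr rfl fun s _ => ?_
  rw [smul_mulVec, dotProduct_smul, vecMulVec_mulVec, dotProduct_smul, smul_eq_mul,
    dotProduct_comm (u s) v]
  simp [sq]

lemma dotProduct_sub_self_le_four_mul_sq {n : Type*} [Fintype n] {B : ℝ} (hB : 0 ≤ B)
    {a b : n → ℝ} (ha : √(∑ i, a i ^ 2) ≤ B) (hb : √(∑ i, b i ^ 2) ≤ B) :
    (a - b) ⬝ᵥ (a - b) ≤ 4 * B ^ 2 := by
  rw [Real.sqrt_le_left hB] at ha hb
  have h : (a - b) ⬝ᵥ (a - b) ≤ ∑ i, (2 * a i ^ 2 + 2 * b i ^ 2) :=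
    Finset.sum_le_sum fun i _ => by
      simp only [Pi.sub_apply]
      nlinarith [sq_nonneg (a i + b i)]
  rw [Finset.sum_add_distrib, ← Finset.mul_sum, ← Finset.mul_sum] at h
  linarith

/-- for a linear function class, the uncertainty
`D_F(X_t; X_[t-1], σ_[t-1])` is bounded by the elliptical norm `‖φ_t‖_{Σ_{t-1}⁻¹}` where
`Σ_{t-1} = Σ_{s<t} σ_s⁻² φ_s φ_sᵀ + (λ/(4B²)) I`. -/
theorem uncertainty_linear_le_elliptical
    {𝒳 : Type*} (d : ℕ) (hd : 1 ≤ d) (B lam : ℝ) (hB : 0 < B) (hlam : 0 < lam)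
    (φ : 𝒳 → Fin d → ℝ) (hφ : ∀ x, Real.sqrt (∑ i, φ x i ^ 2) ≤ 1)
    (F : Set (𝒳 → ℝ))
    (hF : F = { f | ∃ θ : Fin d → ℝ, Real.sqrt (∑ i, θ i ^ 2) ≤ B ∧
      f = fun x => ∑ i, θ i * φ x i })
    (xs : ℕ → 𝒳) (sig : ℕ → ℝ) (hsig : ∀ s, 0 < sig s) (t : ℕ) (ht : 1 ≤ t) :
    Real.sqrt (uncertaintySq F lam xs sig (t - 1) (xs t)) ≤
      Real.sqrt (φ (xs t) ⬝ᵥ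
        ((∑ s ∈ Finset.Icc 1 (t - 1), (sig s ^ 2)⁻¹ • vecMulVec (φ (xs s)) (φ (xs s))
            + (lam / (4 * B ^ 2)) • (1 : Matrix (Fin d) (Fin d) ℝ))⁻¹ *ᵥ φ (xs t))) := by
  have hc : 0 < lam / (4 * B ^ 2) := by positivity
  have hw : ∀ s ∈ Finset.Icc 1 (t - 1), 0 ≤ (sig s ^ 2)⁻¹ := fun s _ => by positivity
  have hA := posDef_sum_smul_vecMulVec_add_smul_one (Finset.Icc 1 (t - 1))
    (fun s => (sig s ^ 2)⁻¹) hw (fun s => φ (xs s)) hc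
  have hnonneg := hA.inv.posSemidef.dotProduct_mulVec_nonneg (φ (xs t))
  rw [star_trivial] at hnonneg
  refine Real.sqrt_le_sqrt (Real.sSup_le ?_ hnonneg)
  rintro r ⟨f₁, hf₁, f₂, hf₂, rfl⟩
  rw [hF] at hf₁ hf₂
  obtain ⟨a, ha, rfl⟩ := hf₁
  obtain ⟨b, hb, rfl⟩ := hf₂
  have hdiff : ∀ x, ∑ i, a i * φ x i - ∑ i, b i * φ x i = (a - b) ⬝ᵥ φ x := fun x =>
    (sub_dotProduct a b (φ x)).symm
  simp only [hdiff]
  have hden : 0 ≤ ∑ s ∈ Finset.Icc 1 (t - 1), (sig s ^ 2)⁻¹ * ((a - b) ⬝ᵥ φ (xs s)) ^ 2 :=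
    Finset.sum_nonneg fun s _ => by positivity
  rw [div_le_iff₀ (by linarith), mul_comm]
  refine (hA.sq_dotProduct_le_s5 (a - b) (φ (xs t))).trans
    (mul_le_mul_of_nonneg_right ?_ hnonneg)
  rw [dotProduct_sum_smul_vecMulVec_add_smul_one_mulVec]
  gcongr
  calc lam / (4 * B ^ 2) * ((a - b) ⬝ᵥ (a - b))
      ≤ lam / (4 * B ^ 2) * (4 * B ^ 2) := by
        gcongr
        exact dotProduct_sub_self_le_four_mul_sq hB.le ha hb
    _ = lam := by field_simp
end

section
/- Variance-aware Freedman inequality: Let M > 0, let (Ω, 𝒢, ℙ) be a probability space with filtration {𝒢_s}_{s=0}^{t}, and let {X_s}_{s∈[t]} be a stochastic process adapted to {𝒢_s} (X_s is 𝒢_s-measurable) such that almost surely E[X_s | 𝒢_{s−1}] = 0 and |X_s| ≤ M for every s ∈ [t]. Then for any δ ∈ (0,1), with probability at least 1 − 2 (log t + 2) δ, Σ_{s=1}^t X_s ≤ 2 √( Σ_{s=1}^t E[X_s² | 𝒢_{s−1}] · log(1/δ) ) + 4 M log(1/δ). -/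
open MeasureTheory

theorem Real.exp_le_one_add_add_three_quarters_sq {y : ℝ} (hy : |y| ≤ 1) :
    Real.exp y ≤ 1 + y + 3 / 4 * y ^ 2 := by
  have h := Real.exp_bound hy (n := 3) (by norm_num)
  have h2 := (abs_le.1 h).2
  norm_num [Finset.sum_range_succ, Nat.factorial] at h2
  have h3 : |y| ^ 3 ≤ y ^ 2 := by
    rw [← sq_abs y]
    nlinarith [sq_nonneg |y|]
  nlinarith [sq_nonneg y]

/-- If `S ≤ L / l + (3 / 4) * l * V` holds on a dyadic grid of parameters `l` starting at `1 / M`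
and reaching below `√(L / V)`, then one of the grid points is nearly optimal. -/
theorem le_two_mul_sqrt_of_dyadic_grid {S V L M : ℝ} {N : ℕ} (hM : 0 < M) (hL : 1 ≤ L)
    (hV : V ≤ 2 ^ N * M ^ 2)
    (h : ∀ k < N + 1, S ≤ L / ((1 / 2) ^ k / M) + 3 / 4 * ((1 / 2) ^ k / M) * V) :
    S ≤ 2 * Real.sqrt (V * L) + 4 * M * L := by
  have hML : 0 < M * L := by positivity
  by_cases hVL : V < L * M ^ 2
  · have h0 := h 0 (by omega)
    have h1 : 3 / 4 * ((1 / 2 : ℝ) ^ 0 / M) * V ≤ 3 / 4 * (M * L) := by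
      have : V / M ≤ M * L := by
        rw [div_le_iff₀ hM]; nlinarith
      calc 3 / 4 * ((1 / 2 : ℝ) ^ 0 / M) * V = 3 / 4 * (V / M) := by simp; ring
        _ ≤ _ := by linarith
    have h2 : L / ((1 / 2 : ℝ) ^ 0 / M) = M * L := by
      simp; ring
    have := Real.sqrt_nonneg (V * L)
    linarith
  · push Not at hVL
    have hVpos : 0 < V := lt_of_lt_of_le (by positivity) hVL
    set x := Real.sqrt (L / V) with hx
    have hx0 : 0 < x := Real.sqrt_pos.2 (by positivity)
    have hxx : x ^ 2 = L / V := Real.sq_sqrt (by positivity)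
    have hLx : L = x ^ 2 * V := by rw [hxx]; field_simp
    have hx1 : x ≤ 1 / M := by
      apply Real.sqrt_le_iff.2 ⟨by positivity, ?_⟩
      rw [div_le_iff₀ hVpos, one_div, inv_pow, ← div_eq_inv_mul, le_div_iff₀ (by positivity)]
      exact hVL
    have hxN : (1 / 2 : ℝ) ^ (N + 1) / M < x := by
      apply Real.lt_sqrt_of_sq_lt
      rw [lt_div_iff₀ hVpos]
      have e : ((1 / 2 : ℝ) ^ (N + 1) / M) ^ 2 * (2 ^ N * M ^ 2) = (1 / 2) ^ (N + 2) := by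
        have : (1 / 2 : ℝ) ^ N * 2 ^ N = 1 := by rw [← mul_pow]; norm_num
        calc _ = (1 / 2 : ℝ) ^ (N + 2) * ((1 / 2 : ℝ) ^ N * 2 ^ N) := by field_simp; ring
          _ = _ := by rw [this, mul_one]
      have h1 : (1 / 2 : ℝ) ^ (N + 2) < 1 := pow_lt_one₀ (by norm_num) (by norm_num) (by omega)
      have h2 := mul_le_mul_of_nonneg_left hV (sq_nonneg ((1 / 2 : ℝ) ^ (N + 1) / M))
      linarith
    have hex : ∃ j, (1 / 2 : ℝ) ^ j / M < x := ⟨_, hxN⟩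
    classical
    have hj := Nat.find_spec hex
    have hjN : Nat.find hex ≤ N + 1 := Nat.find_min' hex hxN
    have hmin := fun m => Nat.find_min hex (m := m)
    generalize Nat.find hex = j at hj hjN hmin
    obtain - | k := j
    · simp only [pow_zero] at hj; linarith
    · have hk := h k (by omega)
      have hkx := not_lt.1 (hmin k (Nat.lt_succ_self k))
      have hl : (1 / 2 : ℝ) ^ k / M < 2 * x := by
        rw [pow_succ] at hj
        have : (1 / 2 : ℝ) ^ k * (1 / 2) / M = (1 / 2 : ℝ) ^ k / M / 2 := by ring
        linarith
      set l := (1 / 2 : ℝ) ^ k / M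
      have hl0 : 0 < l := by positivity
      have hs : Real.sqrt (V * L) = x * V := by
        rw [hLx, show V * (x ^ 2 * V) = (x * V) ^ 2 by ring]
        exact Real.sqrt_sq (by positivity)
      have hq : x ^ 2 / l + 3 / 4 * l ≤ 2 * x := by
        have : x ^ 2 / l ≤ 2 * x - 3 / 4 * l := by
          rw [div_le_iff₀ hl0]
          nlinarith [mul_nonneg (by linarith : (0:ℝ) ≤ x - l / 2)
            (by linarith : (0:ℝ) ≤ 3 / 2 * l - x)]
        linarith
      have := mul_le_mul_of_nonneg_right hq hVpos.le
      have e : L / l = x ^ 2 / l * V := by rw [hLx]; ring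
      rw [hs]
      rw [e] at hk
      nlinarith

section

variable {Ω : Type*} {m0 : MeasurableSpace Ω} {μ : Measure Ω} {𝒢 : Filtration ℕ m0} {X : ℕ → Ω → ℝ}

theorem stronglyMeasurable_exp_freedman (hadapt : ∀ s, Measurable[𝒢 s] (X s)) (l : ℝ) (n : ℕ) :
    StronglyMeasurable[𝒢 n] (fun ω => Real.exp (l * ∑ s ∈ Finset.Icc 1 n, X s ω -
      3 / 4 * l ^ 2 * ∑ s ∈ Finset.Icc 1 n, (μ[fun ω' => X s ω' ^ 2 | 𝒢 (s - 1)]) ω)) := by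
  refine Real.continuous_exp.comp_stronglyMeasurable
    (StronglyMeasurable.sub (StronglyMeasurable.const_mul ?_ l) (StronglyMeasurable.const_mul ?_ _))
  · refine Finset.stronglyMeasurable_fun_sum _ fun s hs => ?_
    exact ((hadapt s).stronglyMeasurable).mono (𝒢.mono (Finset.mem_Icc.1 hs).2)
  · refine Finset.stronglyMeasurable_fun_sum _ fun s hs => ?_
    exact stronglyMeasurable_condExp.mono
      (𝒢.mono ((Nat.sub_le _ _).trans (Finset.mem_Icc.1 hs).2))

variable [IsProbabilityMeasure μ]

theorem condExp_sq_nonneg_and_le {m : MeasurableSpace Ω} (hm : m ≤ m0) {Y : Ω → ℝ} {M : ℝ}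
    (hY : AEStronglyMeasurable[m0] Y μ) (hb : ∀ᵐ ω ∂μ, |Y ω| ≤ M) :
    ∀ᵐ ω ∂μ, 0 ≤ (μ[fun ω' => Y ω' ^ 2 | m]) ω ∧ (μ[fun ω' => Y ω' ^ 2 | m]) ω ≤ M ^ 2 := by
  have hsq : ∀ᵐ ω ∂μ, Y ω ^ 2 ≤ M ^ 2 := by
    filter_upwards [hb] with ω h
    exact sq_le_sq' (abs_le.1 h).1 (abs_le.1 h).2
  have hint : Integrable (fun ω => Y ω ^ 2) μ := by
    refine Integrable.of_bound (hY.pow 2) (M ^ 2) ?_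
    filter_upwards [hsq] with ω h
    rwa [Real.norm_of_nonneg (sq_nonneg _)]
  have h1 : 0 ≤ᵐ[μ] μ[fun ω' => Y ω' ^ 2 | m] :=
    condExp_nonneg (Filter.Eventually.of_forall fun ω => sq_nonneg _)
  have h2 : μ[fun ω' => Y ω' ^ 2 | m] ≤ᵐ[μ] μ[fun _ => M ^ 2 | m] :=
    condExp_mono hint (integrable_const _) hsq
  rw [condExp_const hm] at h2
  filter_upwards [h1, h2] with ω a b using ⟨a, b⟩

theorem integral_mul_exp_le_of_condExp_eq_zero {m : MeasurableSpace Ω} (hm : m ≤ m0)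
    {Y Z : Ω → ℝ} {M B l : ℝ} (hl : 0 ≤ l) (hlM : l * M ≤ 1)
    (hY : AEStronglyMeasurable[m0] Y μ) (hb : ∀ᵐ ω ∂μ, |Y ω| ≤ M) (hmean : μ[Y | m] =ᵐ[μ] 0)
    (hZ : StronglyMeasurable[m] Z) (hZ0 : ∀ ω, 0 ≤ Z ω) (hZB : ∀ᵐ ω ∂μ, Z ω ≤ B) :
    ∫ ω, Z ω * Real.exp (l * Y ω - 3 / 4 * l ^ 2 * (μ[fun ω' => Y ω' ^ 2 | m]) ω) ∂μ ≤
      ∫ ω, Z ω ∂μ := by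
  set v := μ[fun ω' => Y ω' ^ 2 | m] with hv
  have hvm : StronglyMeasurable[m] v := stronglyMeasurable_condExp
  have hv01 := condExp_sq_nonneg_and_le hm hY hb
  set W : Ω → ℝ := fun ω => Z ω * Real.exp (-(3 / 4 * l ^ 2 * v ω)) with hW
  have hWm : StronglyMeasurable[m] W :=
    hZ.mul (Real.continuous_exp.comp_stronglyMeasurable (hvm.const_mul _).neg)
  have hW0 : ∀ ω, 0 ≤ W ω := fun ω => mul_nonneg (hZ0 ω) (Real.exp_pos _).le
  have hWB : ∀ᵐ ω ∂μ, ‖W ω‖ ≤ B := by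
    filter_upwards [hv01, hZB] with ω h1 h2
    rw [Real.norm_of_nonneg (hW0 ω)]
    refine le_trans (mul_le_of_le_one_right (hZ0 ω) (Real.exp_le_one_iff.2 ?_)) h2
    have := mul_nonneg (sq_nonneg l) h1.1
    linarith
  set P : Ω → ℝ := fun ω => 1 + l * Y ω + 3 / 4 * l ^ 2 * Y ω ^ 2 with hP
  have hYi : Integrable Y μ := Integrable.of_bound hY M hb
  have hY2i : Integrable (fun ω => Y ω ^ 2) μ := by
    refine Integrable.of_bound (hY.pow 2) (M ^ 2) ?_
    filter_upwards [hb] with ω h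
    rw [Real.norm_of_nonneg (sq_nonneg _)]
    exact sq_le_sq' (abs_le.1 h).1 (abs_le.1 h).2
  have hA : Integrable (fun ω => 1 + l * Y ω) μ := (integrable_const 1).add (hYi.const_mul l)
  have hPi : Integrable P μ := hA.add (hY2i.const_mul _)
  have hWP : Integrable (fun ω => W ω * P ω) μ :=
    hPi.bdd_mul (hWm.mono hm).aestronglyMeasurable hWB
  have hPc : μ[P | m] =ᵐ[μ] fun ω => 1 + 3 / 4 * l ^ 2 * v ω := by
    have h1 := condExp_add hA (hY2i.const_mul (3 / 4 * l ^ 2)) m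
    have h2 := condExp_add (integrable_const (1 : ℝ)) (hYi.const_mul l) m (μ := μ)
    have h3 := condExp_smul (μ := μ) l Y m
    have h4 := condExp_smul (μ := μ) (3 / 4 * l ^ 2) (fun ω => Y ω ^ 2) m
    have h5 := condExp_const (μ := μ) hm (1 : ℝ)
    filter_upwards [h1, h2, h3, h4, hmean] with ω h1 h2 h3 h4 h6
    have e1 : (μ[P | m]) ω = _ := h1
    have e2 : (μ[fun ω => 1 + l * Y ω | m]) ω = _ := h2
    have e3 : (μ[fun ω => l * Y ω | m]) ω = _ := h3
    have e4 : (μ[fun ω => 3 / 4 * l ^ 2 * Y ω ^ 2 | m]) ω = _ := h4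
    rw [e1, Pi.add_apply, e2, Pi.add_apply, e3, e4, h5]
    simp [h6, hv]
  have hpull : ∫ ω, W ω * P ω ∂μ = ∫ ω, W ω * (1 + 3 / 4 * l ^ 2 * v ω) ∂μ := by
    rw [← integral_condExp hm]
    refine integral_congr_ae ?_
    filter_upwards [condExp_mul_of_stronglyMeasurable_left hWm hWP hPi, hPc] with ω h1 h2
    have e : (μ[fun ω => W ω * P ω | m]) ω = _ := h1
    rw [e, Pi.mul_apply, h2]
  have hZi : Integrable Z μ := by
    refine Integrable.of_bound (hZ.mono hm).aestronglyMeasurable B ?_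
    filter_upwards [hZB] with ω h
    rwa [Real.norm_of_nonneg (hZ0 ω)]
  calc _ ≤ ∫ ω, W ω * P ω ∂μ := by
        refine integral_mono_of_nonneg
          (Filter.Eventually.of_forall fun ω => mul_nonneg (hZ0 ω) (Real.exp_pos _).le) hWP ?_
        filter_upwards [hb] with ω h
        have hly : |l * Y ω| ≤ 1 := by
          rw [abs_mul, abs_of_nonneg hl]
          exact (mul_le_mul_of_nonneg_left h hl).trans hlM
        have h1 := Real.exp_le_one_add_add_three_quarters_sq hly
        have h2 : Real.exp (l * Y ω) ≤ P ω := by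
          simp only [hP]; nlinarith
        have h3 := mul_le_mul_of_nonneg_left h2 (hW0 ω)
        simp only [hW] at h3 ⊢
        rw [sub_eq_add_neg, add_comm, Real.exp_add, ← mul_assoc]
        exact h3
    _ = _ := hpull
    _ ≤ _ := by
        refine integral_mono_ae ?_ hZi ?_
        · have : Integrable (fun ω => W ω * (μ[P | m]) ω) μ :=
            integrable_condExp.bdd_mul (hWm.mono hm).aestronglyMeasurable hWB
          refine this.congr ?_
          filter_upwards [hPc] with ω h
          rw [h]
        · filter_upwards with ω
          have h1 := Real.add_one_le_exp (3 / 4 * l ^ 2 * v ω)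
          calc W ω * (1 + 3 / 4 * l ^ 2 * v ω)
              ≤ W ω * Real.exp (3 / 4 * l ^ 2 * v ω) :=
                mul_le_mul_of_nonneg_left (by linarith) (hW0 ω)
            _ = Z ω := by
                simp only [hW]
                rw [mul_assoc, ← Real.exp_add, neg_add_cancel, Real.exp_zero, mul_one]

variable {t : ℕ} {M l : ℝ}

theorem exp_freedman_ae_le (hadapt : ∀ s, Measurable[𝒢 s] (X s))
    (hbound : ∀ s ∈ Finset.Icc 1 t, ∀ᵐ ω ∂μ, |X s ω| ≤ M) (hl : 0 ≤ l) {n : ℕ} (hn : n ≤ t) :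
    ∀ᵐ ω ∂μ, Real.exp (l * ∑ s ∈ Finset.Icc 1 n, X s ω -
      3 / 4 * l ^ 2 * ∑ s ∈ Finset.Icc 1 n, (μ[fun ω' => X s ω' ^ 2 | 𝒢 (s - 1)]) ω) ≤
      Real.exp (l * (n * M)) := by
  have hall : ∀ᵐ ω ∂μ, ∀ s ∈ Finset.Icc 1 n, |X s ω| ≤ M ∧
      0 ≤ (μ[fun ω' => X s ω' ^ 2 | 𝒢 (s - 1)]) ω := by
    refine (ae_ball_iff (Finset.countable_toSet _)).2 fun s hs => ?_
    have hs' : s ∈ Finset.Icc 1 t := Finset.Icc_subset_Icc_right hn hs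
    filter_upwards [hbound s hs', condExp_sq_nonneg_and_le (𝒢.le (s - 1))
      ((hadapt s).mono (𝒢.le s) le_rfl).aestronglyMeasurable (hbound s hs')] with ω a b
    exact ⟨a, b.1⟩
  filter_upwards [hall] with ω h
  have h1 : ∑ s ∈ Finset.Icc 1 n, X s ω ≤ n * M := by
    have := Finset.sum_le_card_nsmul (Finset.Icc 1 n) (fun s => X s ω) M
      fun s hs => (abs_le.1 (h s hs).1).2
    simpa using this
  have h2 := Finset.sum_nonneg fun s hs => (h s hs).2
  have h3 := mul_le_mul_of_nonneg_left h1 hl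
  have h4 := mul_nonneg (sq_nonneg l) h2
  apply Real.exp_le_exp.2
  linarith

theorem integral_exp_freedman_le_one (hadapt : ∀ s, Measurable[𝒢 s] (X s))
    (hmean : ∀ s ∈ Finset.Icc 1 t, μ[X s | 𝒢 (s - 1)] =ᵐ[μ] 0)
    (hbound : ∀ s ∈ Finset.Icc 1 t, ∀ᵐ ω ∂μ, |X s ω| ≤ M)
    (hl : 0 ≤ l) (hlM : l * M ≤ 1) (n : ℕ) (hn : n ≤ t) :
    ∫ ω, Real.exp (l * ∑ s ∈ Finset.Icc 1 n, X s ω -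
      3 / 4 * l ^ 2 * ∑ s ∈ Finset.Icc 1 n, (μ[fun ω' => X s ω' ^ 2 | 𝒢 (s - 1)]) ω) ∂μ ≤ 1 := by
  induction n with
  | zero => simp
  | succ n ih =>
    have hs : n + 1 ∈ Finset.Icc 1 t := Finset.mem_Icc.2 ⟨by omega, hn⟩
    have key := integral_mul_exp_le_of_condExp_eq_zero (𝒢.le n) hl hlM
      ((hadapt (n + 1)).mono (𝒢.le _) le_rfl).aestronglyMeasurable (hbound _ hs) (hmean _ hs)
      (stronglyMeasurable_exp_freedman (μ := μ) hadapt l n) (fun ω => (Real.exp_pos _).le)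
      (exp_freedman_ae_le hadapt hbound hl (by omega))
    refine le_trans (le_of_eq ?_) (key.trans (ih (by omega)))
    refine integral_congr_ae (Filter.Eventually.of_forall fun ω => ?_)
    simp only [Finset.sum_Icc_succ_top (show 1 ≤ n + 1 by omega), Nat.add_sub_cancel]
    rw [← Real.exp_add]
    congr 1
    ring

theorem measure_freedman_tail_le (hadapt : ∀ s, Measurable[𝒢 s] (X s))
    (hmean : ∀ s ∈ Finset.Icc 1 t, μ[X s | 𝒢 (s - 1)] =ᵐ[μ] 0)
    (hbound : ∀ s ∈ Finset.Icc 1 t, ∀ᵐ ω ∂μ, |X s ω| ≤ M)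
    (hl : 0 < l) (hlM : l * M ≤ 1) (L : ℝ) :
    μ {ω | L / l + 3 / 4 * l * (∑ s ∈ Finset.Icc 1 t, (μ[fun ω' => X s ω' ^ 2 | 𝒢 (s - 1)]) ω)
      < ∑ s ∈ Finset.Icc 1 t, X s ω} ≤ ENNReal.ofReal (Real.exp (-L)) := by
  set f : Ω → ℝ := fun ω => Real.exp (l * ∑ s ∈ Finset.Icc 1 t, X s ω -
      3 / 4 * l ^ 2 * ∑ s ∈ Finset.Icc 1 t, (μ[fun ω' => X s ω' ^ 2 | 𝒢 (s - 1)]) ω) with hf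
  have hfi : Integrable f μ := by
    refine Integrable.of_bound ((stronglyMeasurable_exp_freedman hadapt l t).mono
      (𝒢.le t)).aestronglyMeasurable (Real.exp (l * (t * M))) ?_
    filter_upwards [exp_freedman_ae_le hadapt hbound hl.le le_rfl] with ω h
    rwa [Real.norm_of_nonneg (Real.exp_pos _).le]
  have hmk := mul_meas_ge_le_integral_of_nonneg
    (Filter.Eventually.of_forall fun ω => (Real.exp_pos _).le : 0 ≤ᵐ[μ] f) hfi (Real.exp L)
  have h1 := hmk.trans (integral_exp_freedman_le_one hadapt hmean hbound hl.le hlM t le_rfl)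
  have h2 : μ.real {ω | Real.exp L ≤ f ω} ≤ Real.exp (-L) := by
    rw [Real.exp_neg, ← one_div, le_div_iff₀ (Real.exp_pos _), mul_comm]
    exact h1
  refine le_trans (measure_mono fun ω hω => ?_) (ENNReal.le_ofReal_iff_toReal_le
    (measure_ne_top _ _) (Real.exp_pos _).le |>.2 h2)
  simp only [Set.mem_ofPred_eq] at hω ⊢
  apply Real.exp_le_exp.2
  have h3 := mul_lt_mul_of_pos_left hω hl
  rw [mul_add, mul_div_cancel₀ _ hl.ne'] at h3
  nlinarith

end

/-- Variance-aware Freedman inequality: for an adapted process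
`X_1, …, X_t` with `E[X_s | 𝒢_{s-1}] = 0` and `|X_s| ≤ M` a.s., for any `δ ∈ (0,1)`,
with probability at least `1 − 2(log t + 2)δ`,
`Σ_s X_s ≤ 2√(Σ_s E[X_s² | 𝒢_{s-1}] log(1/δ)) + 4M log(1/δ)`. -/
theorem variance_aware_freedman
    {Ω : Type*} {m0 : MeasurableSpace Ω} (μ : Measure Ω) [IsProbabilityMeasure μ]
    (𝒢 : Filtration ℕ m0) (t : ℕ) (ht : 1 ≤ t) (M : ℝ) (hM : 0 < M)
    (X : ℕ → Ω → ℝ)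
    (hadapt : ∀ s, Measurable[𝒢 s] (X s))
    (hmean : ∀ s ∈ Finset.Icc 1 t, μ[X s | 𝒢 (s - 1)] =ᵐ[μ] 0)
    (hbound : ∀ s ∈ Finset.Icc 1 t, ∀ᵐ ω ∂μ, |X s ω| ≤ M)
    (δ : ℝ) (hδ0 : 0 < δ) (hδ1 : δ < 1) :
    ENNReal.ofReal (1 - 2 * (Real.log t + 2) * δ) ≤
      μ { ω | ∑ s ∈ Finset.Icc 1 t, X s ω ≤
          2 * Real.sqrt ((∑ s ∈ Finset.Icc 1 t, (μ[fun ω' => X s ω' ^ 2 | 𝒢 (s - 1)]) ω)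
              * Real.log (1 / δ))
            + 4 * M * Real.log (1 / δ) } := by
  have hlogt : 0 ≤ Real.log t := Real.log_nonneg (by exact_mod_cast ht)
  by_cases htriv : 1 - 2 * (Real.log t + 2) * δ ≤ 0
  · rw [ENNReal.ofReal_of_nonpos htriv]
    exact zero_le
  push Not at htriv
  have hδ4 : δ < 1 / 4 := by nlinarith
  set L := Real.log (1 / δ) with hL
  have hexpL : Real.exp (-L) = δ := by
    rw [hL, one_div, Real.log_inv, neg_neg, Real.exp_log hδ0]
  have hL1 : 1 ≤ L := by
    rw [hL, Real.le_log_iff_exp_le (by positivity), le_div_iff₀ hδ0]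
    nlinarith [Real.exp_one_lt_d9]
  set N := Nat.log 2 t + 1 with hN
  have hNcard : ((N + 1 : ℕ) : ℝ) ≤ 2 * (Real.log t + 2) := by
    have h1 : (Nat.log 2 t : ℝ) * Real.log 2 ≤ Real.log t := by
      rw [← Real.log_pow]
      apply Real.log_le_log (by positivity)
      exact_mod_cast Nat.pow_log_le_self 2 (by omega)
    have h2 := Real.log_two_gt_d9
    have h3 : (0 : ℝ) ≤ Nat.log 2 t := Nat.cast_nonneg _
    rw [hN]; push_cast
    nlinarith
  have htN : (t : ℝ) ≤ 2 ^ N := by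
    exact_mod_cast (Nat.lt_pow_succ_log_self (by norm_num) t).le
  set V : Ω → ℝ := fun ω => ∑ s ∈ Finset.Icc 1 t, (μ[fun ω' => X s ω' ^ 2 | 𝒢 (s - 1)]) ω with hV
  have hVle : ∀ᵐ ω ∂μ, V ω ≤ 2 ^ N * M ^ 2 := by
    have hall : ∀ᵐ ω ∂μ, ∀ s ∈ Finset.Icc 1 t,
        (μ[fun ω' => X s ω' ^ 2 | 𝒢 (s - 1)]) ω ≤ M ^ 2 := by
      refine (ae_ball_iff (Finset.countable_toSet _)).2 fun s hs => ?_
      filter_upwards [condExp_sq_nonneg_and_le (𝒢.le (s - 1))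
        ((hadapt s).mono (𝒢.le s) le_rfl).aestronglyMeasurable (hbound s hs)] with ω b using b.2
    filter_upwards [hall] with ω h
    have h1 := Finset.sum_le_card_nsmul (Finset.Icc 1 t) _ (M ^ 2) h
    simp only [Nat.card_Icc, Nat.add_sub_cancel, nsmul_eq_mul] at h1
    exact h1.trans (mul_le_mul_of_nonneg_right htN (sq_nonneg M))
  set good := { ω | ∑ s ∈ Finset.Icc 1 t, X s ω ≤ 2 * Real.sqrt (V ω * L) + 4 * M * L } with hgood
  set bad : ℕ → Set Ω := fun k => {ω | L / ((1 / 2 : ℝ) ^ k / M) +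
    3 / 4 * ((1 / 2 : ℝ) ^ k / M) * V ω < ∑ s ∈ Finset.Icc 1 t, X s ω} with hbad
  have hbadle : ∀ k, μ (bad k) ≤ ENNReal.ofReal δ := fun k => by
    rw [← hexpL]
    refine measure_freedman_tail_le hadapt hmean hbound (by positivity) ?_ L
    rw [div_mul_cancel₀ _ hM.ne']
    exact pow_le_one₀ (by norm_num) (by norm_num)
  have hcover : (Set.univ : Set Ω) ≤ᵐ[μ] (good ∪ ⋃ k ∈ Finset.range (N + 1), bad k : Set Ω) := by
    filter_upwards [hVle] with ω hω _
    by_cases hb : ω ∈ ⋃ k ∈ Finset.range (N + 1), bad k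
    · exact Or.inr hb
    · refine Or.inl (le_two_mul_sqrt_of_dyadic_grid hM hL1 hω fun k hk => ?_)
      by_contra hc
      exact hb (Set.mem_biUnion (Finset.mem_coe.2 (Finset.mem_range.2 hk)) (not_le.1 hc))
  have hsum : 1 ≤ μ good + ENNReal.ofReal (2 * (Real.log t + 2) * δ) := by
    calc 1 = μ Set.univ := measure_univ.symm
      _ ≤ μ (good ∪ ⋃ k ∈ Finset.range (N + 1), bad k) := measure_mono_ae hcover
      _ ≤ μ good + μ (⋃ k ∈ Finset.range (N + 1), bad k) := measure_union_le _ _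
      _ ≤ μ good + ∑ k ∈ Finset.range (N + 1), μ (bad k) := by
          gcongr; exact measure_biUnion_finset_le _ _
      _ ≤ μ good + ∑ k ∈ Finset.range (N + 1), ENNReal.ofReal δ := by
          gcongr with k; exact hbadle k
      _ ≤ _ := by
          gcongr
          rw [Finset.sum_const, Finset.card_range, nsmul_eq_mul, ← ENNReal.ofReal_natCast,
            ← ENNReal.ofReal_mul (Nat.cast_nonneg _)]
          exact ENNReal.ofReal_le_ofReal (mul_le_mul_of_nonneg_right hNcard hδ0.le)
  rw [ENNReal.ofReal_sub _ (by positivity), ENNReal.ofReal_one]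
  exact tsub_le_iff_right.2 hsum
end
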